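/- There exist τ₀ ∈ (0,1) and C > 0, depending only on κ and the coefficients d_{κ−2j}, such that the following holds. Let h : ℝ → ℂ be measurable with h ∈ L¹(ℝ) ∩ L^∞(ℝ), and suppose there is A > 0 with ∫_{|ξ| ≥ L} |h(ξ)| dξ ≤ A/L^{κ−1} for every L ≥ 1. Then for every real β with 0 < |β| ≤ τ₀, ∫_ℝ |h(ξ)| / |1 + β P(ξ)|^{(κ−1)/κ} dξ ≤ C (‖h‖_{L¹} + ‖h‖_{L^∞} + A), with a bound uniform in β. -/

import Mathlib

open MeasureTheory Real
open scoped ENNReal NNReal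

/-- The dispersion symbol `P(y) = Σ_{0 ≤ 2j < κ} d_{κ−2j} y^{κ−2j}`. -/
noncomputable def P (κ : ℕ) (d : ℕ → ℝ) (y : ℝ) : ℝ :=
  ∑ j ∈ Finset.range ((κ + 1) / 2), d (κ - 2 * j) * y ^ (κ - 2 * j)

/-- The sum of the absolute values of the coefficients of the dispersion symbol. -/
noncomputable def coeffNorm (κ : ℕ) (d : ℕ → ℝ) : ℝ :=
  ∑ j ∈ Finset.range ((κ + 1) / 2), |d (κ - 2 * j)|

/-- The derivative of the dispersion symbol. -/
noncomputable def symbolDeriv (κ : ℕ) (d : ℕ → ℝ) (y : ℝ) : ℝ :=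
  ∑ j ∈ Finset.range ((κ + 1) / 2), d (κ - 2 * j) * ((κ - 2 * j : ℕ) * y ^ (κ - 2 * j - 1))

theorem hasDerivAt_P (κ : ℕ) (d : ℕ → ℝ) (y : ℝ) :
    HasDerivAt (P κ d) (symbolDeriv κ d y) y := by
  unfold P symbolDeriv
  exact HasDerivAt.fun_sum fun j _ => (hasDerivAt_pow _ y).const_mul _

theorem measurable_P (κ : ℕ) (d : ℕ → ℝ) : Measurable (P κ d) :=
  Continuous.measurable <| continuous_iff_continuousAt.2 fun y => (hasDerivAt_P κ d y).continuousAt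

theorem one_le_coeffNorm {κ : ℕ} (hκ : 2 ≤ κ) {d : ℕ → ℝ} (hd : d κ = 1) :
    1 ≤ coeffNorm κ d := by
  have h0 : 0 ∈ Finset.range ((κ + 1) / 2) := Finset.mem_range.2 (by omega)
  have := Finset.single_le_sum (f := fun j => |d (κ - 2 * j)|) (fun j _ => abs_nonneg _) h0
  simpa [coeffNorm, hd] using this

theorem abs_P_le (κ : ℕ) (d : ℕ → ℝ) {r y : ℝ} (hr : 1 ≤ r) (hy : |y| ≤ r) :
    |P κ d y| ≤ coeffNorm κ d * r ^ κ := by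
  unfold P coeffNorm
  rw [Finset.sum_mul]
  refine (Finset.abs_sum_le_sum_abs _ _).trans (Finset.sum_le_sum fun j _ => ?_)
  rw [abs_mul, abs_pow]
  gcongr
  exact (pow_le_pow_left₀ (abs_nonneg _) hy _).trans (pow_le_pow_right₀ hr (Nat.sub_le _ _))

theorem le_abs_symbolDeriv {κ : ℕ} (hκ : 2 ≤ κ) {d : ℕ → ℝ} (hd : d κ = 1) {y : ℝ}
    (hy : 2 * coeffNorm κ d ≤ |y|) : |y| ^ (κ - 1) / 2 ≤ |symbolDeriv κ d y| := by
  have hM := one_le_coeffNorm hκ hd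
  have h1 : 1 ≤ |y| := by linarith
  obtain ⟨n, hn⟩ : ∃ n, (κ + 1) / 2 = n + 1 := ⟨(κ + 1) / 2 - 1, by omega⟩
  set rest : ℝ := ∑ j ∈ Finset.range n,
    d (κ - 2 * (j + 1)) * ((κ - 2 * (j + 1) : ℕ) * y ^ (κ - 2 * (j + 1) - 1)) with hrest
  have hsplit : symbolDeriv κ d y = rest + κ * y ^ (κ - 1) := by
    simp [symbolDeriv, hn, Finset.sum_range_succ', hd, hrest]
  have hbound : |rest| ≤ coeffNorm κ d * (κ * |y| ^ (κ - 2)) := by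
    have hle : ∑ j ∈ Finset.range n, |d (κ - 2 * (j + 1))| ≤ coeffNorm κ d := by
      rw [coeffNorm, hn, Finset.sum_range_succ']
      exact le_add_of_nonneg_right (abs_nonneg _)
    refine le_trans ?_ (mul_le_mul_of_nonneg_right hle (by positivity))
    rw [Finset.sum_mul]
    refine (Finset.abs_sum_le_sum_abs _ _).trans (Finset.sum_le_sum fun j _ => ?_)
    rw [abs_mul, abs_mul, abs_pow, Nat.abs_cast]
    have hexp : |y| ^ (κ - 2 * (j + 1) - 1) ≤ |y| ^ (κ - 2) :=
      pow_le_pow_right₀ h1 (by omega)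
    gcongr ?_ * (?_ * ?_)
    exact_mod_cast Nat.sub_le _ _
  have hpow : |y| ^ (κ - 1) = |y| ^ (κ - 2) * |y| := by
    rw [← pow_succ]; congr 1; omega
  have hκ' : (2 : ℝ) ≤ κ := by exact_mod_cast hκ
  have htri : κ * |y| ^ (κ - 1) - |rest| ≤ |symbolDeriv κ d y| := by
    have := abs_sub_abs_le_abs_sub (κ * y ^ (κ - 1)) (-rest)
    rw [abs_neg, abs_mul, abs_pow, Nat.abs_cast, sub_neg_eq_add, add_comm _ rest] at this
    rwa [hsplit]
  have hhalf : coeffNorm κ d * (κ * |y| ^ (κ - 2)) ≤ κ * |y| ^ (κ - 1) / 2 := by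
    rw [hpow]
    have : 0 ≤ (κ : ℝ) * |y| ^ (κ - 2) := by positivity
    nlinarith
  have : 0 ≤ |y| ^ (κ - 1) := by positivity
  nlinarith

/-- Change of variables along a function whose derivative is bounded away from zero. -/
theorem ofReal_mul_lintegral_comp_le {f f' : ℝ → ℝ} {D s U : Set ℝ} {m : ℝ} (hD : D.OrdConnected)
    (hs : MeasurableSet s) (hsD : s ⊆ D) (hf : ∀ x, HasDerivAt f (f' x) x) (hm : 0 < m)
    (hf' : ∀ x ∈ D, m ≤ |f' x|) (hU : Set.MapsTo f s U) (G : ℝ → ℝ≥0∞) :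
    ENNReal.ofReal m * ∫⁻ x in s, G (f x) ≤ ∫⁻ u in U, G u := by
  have hlt : ∀ a ∈ D, ∀ b ∈ D, a < b → f a ≠ f b := by
    intro a ha b hb hab heq
    obtain ⟨c, hc, hc0⟩ := exists_hasDerivAt_eq_zero hab
      (fun x _ => (hf x).continuousAt.continuousWithinAt) heq (fun x _ => hf x)
    have := hf' c (hD.out ha hb (Set.Ioo_subset_Icc_self hc))
    rw [hc0, abs_zero] at this
    linarith
  have hinj : Set.InjOn f s := by
    intro a ha b hb heq
    rcases lt_trichotomy a b with h | h | h
    · exact absurd heq (hlt a (hsD ha) b (hsD hb) h)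
    · exact h
    · exact absurd heq.symm (hlt b (hsD hb) a (hsD ha) h)
  rw [← lintegral_const_mul' _ _ ENNReal.ofReal_ne_top]
  calc ∫⁻ x in s, ENNReal.ofReal m * G (f x)
      ≤ ∫⁻ x in s, ENNReal.ofReal |f' x| * G (f x) := by
        refine setLIntegral_mono' hs fun x hx => ?_
        gcongr
        exact hf' x (hsD hx)
    _ = ∫⁻ u in f '' s, G u :=
        (lintegral_image_eq_lintegral_abs_deriv_mul hs
          (fun x _ => (hf x).hasDerivWithinAt) hinj G).symm
    _ ≤ ∫⁻ u in U, G u := lintegral_mono_set hU.image_subset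

theorem lintegral_Ioc_inv_rpow {p b : ℝ} (hp : p < 1) (hb : 0 < b) :
    ∫⁻ u in Set.Ioc 0 b, (ENNReal.ofReal (|u| ^ p))⁻¹ = ENNReal.ofReal (b ^ (1 - p) / (1 - p)) := by
  have h1 : ∫⁻ u in Set.Ioc 0 b, (ENNReal.ofReal (|u| ^ p))⁻¹
      = ∫⁻ u in Set.Ioc 0 b, ENNReal.ofReal (u ^ (-p)) := by
    refine setLIntegral_congr_fun measurableSet_Ioc fun u hu => ?_
    rw [abs_of_pos hu.1, ← ENNReal.ofReal_inv_of_pos (rpow_pos_of_pos hu.1 _), rpow_neg hu.1.le]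
  have hint : IntervalIntegrable (fun u : ℝ => u ^ (-p)) volume 0 b :=
    intervalIntegral.intervalIntegrable_rpow' (by linarith)
  rw [h1, ← ofReal_integral_eq_lintegral_ofReal hint.1
    ((ae_restrict_mem measurableSet_Ioc).mono fun u hu => rpow_nonneg hu.1.le _),
    ← intervalIntegral.integral_of_le hb.le, integral_rpow (Or.inl (by linarith)),
    zero_rpow (by linarith), sub_zero, neg_add_eq_sub]

theorem lintegral_Ioo_inv_rpow_le {p b : ℝ} (hp : p < 1) (hb : 0 < b) :
    ∫⁻ u in Set.Ioo (-b) b, (ENNReal.ofReal (|u| ^ p))⁻¹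
      ≤ ENNReal.ofReal (2 * (b ^ (1 - p) / (1 - p))) := by
  have hneg : ∫⁻ u in Set.Ioo (-b) 0, (ENNReal.ofReal (|u| ^ p))⁻¹
      ≤ ∫⁻ u in Set.Ioc 0 b, (ENNReal.ofReal (|u| ^ p))⁻¹ := by
    have := ofReal_mul_lintegral_comp_le (f := fun x => -x) (f' := fun _ => -1) (m := 1)
      (s := Set.Ioo (-b) 0) (U := Set.Ioc 0 b) Set.ordConnected_univ measurableSet_Ioo
      (Set.subset_univ _) (fun x => hasDerivAt_neg x) one_pos (by simp)
      (fun x hx => ⟨by linarith [hx.2], by linarith [hx.1]⟩)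
      (fun u => (ENNReal.ofReal (|u| ^ p))⁻¹)
    simpa using this
  have hcover : Set.Ioo (-b) b ⊆ (Set.Ioo (-b) 0 ∪ {0}) ∪ Set.Ioc 0 b := by
    intro x hx
    rcases lt_trichotomy x 0 with h | h | h
    · exact Or.inl (Or.inl ⟨hx.1, h⟩)
    · exact Or.inl (Or.inr h)
    · exact Or.inr ⟨h, hx.2.le⟩
  have hnn : 0 ≤ b ^ (1 - p) / (1 - p) := div_nonneg (by positivity) (by linarith)
  calc _ ≤ _ := lintegral_mono_set hcover
    _ ≤ _ := lintegral_union_le _ _ _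
    _ ≤ (_ + _) + _ := add_le_add_left (lintegral_union_le _ _ _) _
    _ ≤ _ := by
      rw [Measure.restrict_singleton, Real.volume_singleton, zero_smul, lintegral_zero_measure,
        add_zero, two_mul, ENNReal.ofReal_add hnn hnn]
      rw [lintegral_Ioc_inv_rpow hp hb] at hneg ⊢
      gcongr

/-- The singular weight has a uniformly controlled integral over the part of an order-connected set
where the derivative is at least `m` and the function is smaller than `b`. -/
theorem setLIntegral_inv_rpow_comp_le {f f' : ℝ → ℝ} {D s : Set ℝ} {m b p : ℝ}
    (hD : D.OrdConnected) (hs : MeasurableSet s) (hsD : s ⊆ D)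
    (hf : ∀ x, HasDerivAt f (f' x) x) (hm : 0 < m) (hf' : ∀ x ∈ D, m ≤ |f' x|)
    (hp : p < 1) (hb : 0 < b) (hsb : ∀ x ∈ s, |f x| < b) :
    ∫⁻ x in s, (ENNReal.ofReal (|f x| ^ p))⁻¹
      ≤ ENNReal.ofReal (2 * (b ^ (1 - p) / (1 - p)) / m) := by
  rw [ENNReal.ofReal_div_of_pos hm, ENNReal.le_div_iff_mul_le (Or.inl (by simpa using hm))
    (Or.inl ENNReal.ofReal_ne_top), mul_comm]
  exact (ofReal_mul_lintegral_comp_le hD hs hsD hf hm hf'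
    (fun x hx => abs_lt.1 (hsb x hx)) _).trans (lintegral_Ioo_inv_rpow_le hp hb)

theorem ofReal_div_ofReal_rpow_le {a g c p : ℝ} (hc : 0 < c) (hp : 0 ≤ p) (hg : c ≤ g) :
    ENNReal.ofReal a / ENNReal.ofReal (g ^ p) ≤ ENNReal.ofReal (c ^ p)⁻¹ * ENNReal.ofReal a := by
  rw [ENNReal.ofReal_inv_of_pos (rpow_pos_of_pos hc p), mul_comm, ← div_eq_mul_inv]
  gcongr

/-- Splitting the singular integral according to the size of `f`: away from zero the weight is
bounded, and near zero `h` is bounded and `f` is a change of variables on each half-line. -/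
theorem lintegral_div_rpow_le {h : ℝ → ℂ} (hh : Measurable h) (hint : Integrable h)
    (htop : eLpNorm h ⊤ volume ≠ ⊤) {f f' : ℝ → ℝ} (hf : ∀ x, HasDerivAt f (f' x) x)
    {p b K T m a : ℝ} (hp0 : 0 ≤ p) (hp1 : p < 1) (hb : 0 < b) (hm : 0 < m)
    (htail : ∫ ξ in {x : ℝ | T ≤ |x|}, ‖h ξ‖ ≤ a)
    (hlarge : ∀ x, |f x| < 1 / 2 → T ≤ |x| ∧ K ≤ |x|)
    (hf' : ∀ x, K ≤ |x| → m ≤ |f' x|) :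
    ∫⁻ ξ, ENNReal.ofReal ‖h ξ‖ / ENNReal.ofReal (|f ξ| ^ p) ≤
      ENNReal.ofReal (2 * (∫ ξ, ‖h ξ‖) + (b ^ p)⁻¹ * a +
        2 * ((eLpNorm h ⊤ volume).toReal * (2 * (b ^ (1 - p) / (1 - p)) / m))) := by
  have hfm : Measurable f :=
    Continuous.measurable <| continuous_iff_continuousAt.2 fun y => (hf y).continuousAt
  have hTm : MeasurableSet {x : ℝ | T ≤ |x|} := measurableSet_le measurable_const measurable_abs
  have hsm : MeasurableSet {x : ℝ | |f x| < b} := measurableSet_lt hfm.abs measurable_const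
  have hnm : Measurable fun ξ => ENNReal.ofReal ‖h ξ‖ := hh.norm.ennreal_ofReal
  set H := (eLpNorm h ⊤ volume).toReal
  have hH : ENNReal.ofReal H = eLpNorm h ⊤ volume := ENNReal.ofReal_toReal htop
  set w : ℝ → ℝ≥0∞ := fun ξ => ENNReal.ofReal H * (ENNReal.ofReal (|f ξ| ^ p))⁻¹
  have hwm : Measurable w := by fun_prop
  set s₁ := {x : ℝ | |f x| < b} ∩ Set.Ici K
  set s₂ := {x : ℝ | |f x| < b} ∩ Set.Iic (-K)
  have hs₁m : MeasurableSet s₁ := hsm.inter measurableSet_Ici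
  have hs₂m : MeasurableSet s₂ := hsm.inter measurableSet_Iic
  have hpt : ∀ᵐ ξ, ENNReal.ofReal ‖h ξ‖ / ENNReal.ofReal (|f ξ| ^ p) ≤
      ENNReal.ofReal 2 * ENNReal.ofReal ‖h ξ‖ +
        {x : ℝ | T ≤ |x|}.indicator
          (fun ξ => ENNReal.ofReal (b ^ p)⁻¹ * ENNReal.ofReal ‖h ξ‖) ξ +
        (s₁.indicator w ξ + s₂.indicator w ξ) := by
    filter_upwards [ae_le_eLpNormEssSup (f := h) (μ := volume)] with ξ hξ
    rw [← eLpNorm_exponent_top, ← hH, ← ofReal_norm] at hξ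
    rcases le_or_gt (1 / 2) |f ξ| with h1 | h1
    · refine le_add_right (le_add_right ((ofReal_div_ofReal_rpow_le one_half_pos hp0 h1).trans ?_))
      gcongr
      rw [← inv_rpow (by norm_num)]
      calc ((1 / 2 : ℝ)⁻¹) ^ p ≤ ((1 / 2 : ℝ)⁻¹) ^ (1 : ℝ) :=
            rpow_le_rpow_of_exponent_le (by norm_num) hp1.le
        _ = 2 := by norm_num
    obtain ⟨hT, hKx⟩ := hlarge ξ h1
    rcases le_or_gt b |f ξ| with h2 | h2
    · refine le_add_right (le_add_left ?_)
      rw [Set.indicator_of_mem (by exact hT)]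
      exact ofReal_div_ofReal_rpow_le hb hp0 h2
    · have hle : ENNReal.ofReal ‖h ξ‖ / ENNReal.ofReal (|f ξ| ^ p) ≤ w ξ := by
        rw [div_eq_mul_inv]
        exact mul_le_mul_left hξ _
      refine le_add_left ?_
      rcases le_abs.1 hKx with h3 | h3
      · refine le_add_right ?_
        rwa [Set.indicator_of_mem (show ξ ∈ s₁ from ⟨h2, h3⟩)]
      · refine le_add_left ?_
        rwa [Set.indicator_of_mem (show ξ ∈ s₂ from ⟨h2, le_neg_of_le_neg h3⟩)]
  have hw : ∀ D : Set ℝ, D.OrdConnected → (∀ x ∈ D, K ≤ |x|) →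
      MeasurableSet ({x : ℝ | |f x| < b} ∩ D) →
      ∫⁻ ξ in {x : ℝ | |f x| < b} ∩ D, w ξ
        ≤ ENNReal.ofReal (H * (2 * (b ^ (1 - p) / (1 - p)) / m)) := by
    intro D hD hDK hms
    rw [lintegral_const_mul' _ _ ENNReal.ofReal_ne_top, ENNReal.ofReal_mul ENNReal.toReal_nonneg]
    gcongr
    exact setLIntegral_inv_rpow_comp_le hD hms Set.inter_subset_right hf hm
      (fun x hx => hf' x (hDK x hx)) hp1 hb fun x hx => hx.1
  have hw₁ := hw (Set.Ici K) Set.ordConnected_Ici (fun x hx => le_trans hx (le_abs_self x)) hs₁m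
  have hw₂ := hw (Set.Iic (-K)) Set.ordConnected_Iic
    (fun x hx => (le_neg_of_le_neg hx).trans (neg_le_abs x)) hs₂m
  have hnorm : ∫⁻ ξ, ENNReal.ofReal ‖h ξ‖ = ENNReal.ofReal (∫ ξ, ‖h ξ‖) :=
    (ofReal_integral_eq_lintegral_ofReal hint.norm (ae_of_all _ fun _ => norm_nonneg _)).symm
  have htail' : ∫⁻ ξ in {x : ℝ | T ≤ |x|}, ENNReal.ofReal ‖h ξ‖ ≤ ENNReal.ofReal a := by
    rw [← ofReal_integral_eq_lintegral_ofReal hint.norm.integrableOn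
      (ae_of_all _ fun _ => norm_nonneg _)]
    exact ENNReal.ofReal_le_ofReal htail
  have ha : 0 ≤ a := le_trans (integral_nonneg fun _ => norm_nonneg _) htail
  have hI : 0 ≤ ∫ ξ, ‖h ξ‖ := integral_nonneg fun _ => norm_nonneg _
  have hW : 0 ≤ H * (2 * (b ^ (1 - p) / (1 - p)) / m) := by
    have : 0 < 1 - p := by linarith
    have : 0 ≤ H := ENNReal.toReal_nonneg
    positivity
  refine (lintegral_mono_ae hpt).trans ?_
  rw [lintegral_add_right _ (by fun_prop (disch := assumption)),
    lintegral_add_left (hnm.const_mul _), lintegral_add_left (hwm.indicator hs₁m),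
    lintegral_indicator hTm, lintegral_indicator hs₁m, lintegral_indicator hs₂m,
    lintegral_const_mul _ hnm, lintegral_const_mul _ hnm, hnorm,
    ENNReal.ofReal_add (by positivity) (by positivity),
    ENNReal.ofReal_add (by positivity) (by positivity), ENNReal.ofReal_mul zero_le_two,
    ENNReal.ofReal_mul (by positivity : 0 ≤ (b ^ p)⁻¹), two_mul (H * _), ENNReal.ofReal_add hW hW]
  gcongr

theorem abs_lower_bound_of_abs_one_add_mul_P_lt {κ : ℕ} (hκ : 2 ≤ κ) {d : ℕ → ℝ} (hd : d κ = 1)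
    {β x : ℝ} (hβ : |β| ≤ (4 * coeffNorm κ d * (2 * coeffNorm κ d) ^ κ)⁻¹)
    (hx : |1 + β * P κ d x| < 1 / 2) :
    2 * coeffNorm κ d ≤ |x| ∧ 1 ≤ 2 * coeffNorm κ d * |β| * |x| ^ κ := by
  have hM := one_le_coeffNorm hκ hd
  set M := coeffNorm κ d
  have hbig : 1 / 2 < |β| * |P κ d x| := by
    rw [← abs_mul]
    have := abs_lt.1 hx
    rw [lt_abs]
    right
    linarith [this.2]
  have hR : 2 * M ≤ |x| := by
    by_contra! hlt
    have h1 := abs_P_le κ d (by linarith : 1 ≤ 2 * M) hlt.le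
    have h2 : |β| * |P κ d x| ≤ (4 * M * (2 * M) ^ κ)⁻¹ * (M * (2 * M) ^ κ) := by gcongr
    have h3 : (4 * M * (2 * M) ^ κ)⁻¹ * (M * (2 * M) ^ κ) = 1 / 4 := by
      have : M ≠ 0 := by positivity
      field_simp
    linarith
  refine ⟨hR, ?_⟩
  have h1 := mul_le_mul_of_nonneg_left
    (abs_P_le κ d (by linarith : 1 ≤ |x|) le_rfl) (abs_nonneg β)
  linarith

/-- Singular-weight integral bound, uniform in `β`, under the tail-decay
assumption `∫_{|ξ|≥L}|h| ≤ A/L^{κ−1}` for all `L ≥ 1`: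
`∫ |h(ξ)|/|1 + βP(ξ)|^{(κ−1)/κ} dξ ≤ C (‖h‖₁ + ‖h‖∞ + A)` for `0 < |β| ≤ τ₀`. -/
theorem singular_integral_bound_uniform (κ : ℕ) (hκ : 2 ≤ κ) (d : ℕ → ℝ) (hd : d κ = 1) :
    ∃ τ₀ : ℝ, τ₀ ∈ Set.Ioo (0:ℝ) 1 ∧ ∃ C : ℝ, 0 < C ∧
      ∀ h : ℝ → ℂ, Measurable h → Integrable h → eLpNorm h ⊤ volume ≠ ⊤ →
        ∀ A : ℝ, 0 < A →
          (∀ L : ℝ, 1 ≤ L → (∫ ξ in {x : ℝ | L ≤ |x|}, ‖h ξ‖) ≤ A / L ^ (κ - 1)) →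
          ∀ β : ℝ, β ≠ 0 → |β| ≤ τ₀ →
            (∫⁻ ξ : ℝ, ENNReal.ofReal ‖h ξ‖ /
                ENNReal.ofReal (|1 + β * P κ d ξ| ^ (((κ : ℝ) - 1) / κ))) ≤
              ENNReal.ofReal (C * ((∫ ξ : ℝ, ‖h ξ‖) +
                (eLpNorm h ⊤ volume).toReal + A)) := by
  have hM := one_le_coeffNorm hκ hd
  have hlower := @abs_lower_bound_of_abs_one_add_mul_P_lt κ hκ d hd
  have hderiv := @le_abs_symbolDeriv κ hκ d hd
  set M := coeffNorm κ d
  have hκ' : (2 : ℝ) ≤ κ := by exact_mod_cast hκ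
  have hκ0 : (κ : ℝ) ≠ 0 := by positivity
  set p : ℝ := ((κ : ℝ) - 1) / κ with hp
  have hp1 : 1 - p = 1 / κ := by rw [hp]; field_simp; ring
  have hp0 : 0 ≤ p := div_nonneg (by linarith) (by linarith)
  have hplt : p < 1 := by
    have : 0 < 1 / (κ : ℝ) := by positivity
    linarith
  set Q : ℝ := (2 * M) ^ p with hQ
  have hQ0 : 0 < Q := by positivity
  have hpow1 : 1 ≤ (2 * M) ^ κ := one_le_pow₀ (by linarith)
  have hτ4 : 4 * M ≤ 4 * M * (2 * M) ^ κ := le_mul_of_one_le_right (by linarith) hpow1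
  refine ⟨(4 * M * (2 * M) ^ κ)⁻¹, ⟨by positivity, inv_lt_one_of_one_lt₀ (by linarith)⟩,
    2 + Q + 8 * κ * Q, by positivity, ?_⟩
  intro h hh hint htop A hA htail β hβ0 hβ
  have hb : 0 < |β| := abs_pos.2 hβ0
  have hb4 : |β| * (4 * M) ≤ 1 := by
    have h1 : |β| ≤ (4 * M)⁻¹ := hβ.trans (inv_anti₀ (by positivity) hτ4)
    calc |β| * (4 * M) ≤ (4 * M)⁻¹ * (4 * M) := by gcongr
      _ = 1 := inv_mul_cancel₀ (by positivity)
  set b := |β|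
  set L : ℝ := ((2 * M * b)⁻¹) ^ (1 / (κ : ℝ)) with hL
  have hX : 0 < 2 * M * b := by positivity
  have hL1 : 1 ≤ L := one_le_rpow ((one_le_inv₀ hX).2 (by nlinarith)) (by positivity)
  have hLκ : L ^ κ = (2 * M * b)⁻¹ := by
    rw [hL, ← rpow_natCast, ← rpow_mul (by positivity), one_div_mul_cancel hκ0, rpow_one]
  have hLκ1 : L ^ (κ - 1) = (Q * b ^ p)⁻¹ := by
    rw [hQ, ← mul_rpow (by positivity) hb.le, ← inv_rpow hX.le, hL, ← rpow_natCast,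
      ← rpow_mul (by positivity), Nat.cast_sub (by omega), Nat.cast_one, hp]
    congr 1
    ring
  have hbp : 0 < b ^ p := by positivity
  have hf : ∀ x, HasDerivAt (fun x => 1 + β * P κ d x) (β * symbolDeriv κ d x) x :=
    fun x => ((hasDerivAt_P κ d x).const_mul β).const_add 1
  have hfar : ∀ x, |1 + β * P κ d x| < 1 / 2 → L ≤ |x| ∧ max (2 * M) L ≤ |x| := by
    intro x hx
    obtain ⟨h1, h2⟩ := hlower hβ hx
    have h3 : L ≤ |x| := by
      refine le_of_pow_le_pow_left₀ (by omega : κ ≠ 0) (abs_nonneg x) ?_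
      rw [hLκ, inv_le_iff_one_le_mul₀ hX, mul_comm]
      exact h2
    exact ⟨h3, max_le h1 h3⟩
  have hf' : ∀ x, max (2 * M) L ≤ |x| → b * ((Q * b ^ p)⁻¹ / 2) ≤ |β * symbolDeriv κ d x| := by
    intro x hx
    rw [abs_mul, ← hLκ1]
    refine mul_le_mul_of_nonneg_left (le_trans ?_ (hderiv ((le_max_left _ _).trans hx))) hb.le
    have := (le_max_right _ _).trans hx
    gcongr
  have key := lintegral_div_rpow_le hh hint htop hf hp0 hplt hb (by positivity) (htail L hL1)
    hfar hf'
  refine key.trans (ENNReal.ofReal_le_ofReal ?_)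
  have hI : 0 ≤ ∫ ξ, ‖h ξ‖ := integral_nonneg fun _ => norm_nonneg _
  have hH : 0 ≤ (eLpNorm h ⊤ volume).toReal := ENNReal.toReal_nonneg
  set I := ∫ ξ, ‖h ξ‖
  set H := (eLpNorm h ⊤ volume).toReal
  have e1 : (b ^ p)⁻¹ * (A / L ^ (κ - 1)) = Q * A := by
    rw [hLκ1]; field_simp
  have e2 : 2 * (b ^ (1 - p) / (1 - p)) / (b * ((Q * b ^ p)⁻¹ / 2)) = 4 * κ * Q := by
    have : b ^ (1 - p) = b / b ^ p := by rw [rpow_sub hb, rpow_one]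
    rw [this, hp1]
    field_simp
    ring
  rw [e1, e2]
  have : 0 ≤ 8 * κ * Q := by positivity
  nlinarith [mul_nonneg hQ0.le hI, mul_nonneg hQ0.le hH, mul_nonneg this hI, mul_nonneg this hA.le]
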